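/- For every n ≥ 0, the abelian complexity function ρ of the ordinary paperfolding word satisfies ρ(16n+5) = ρ(4n+1) + 2. -/

import Mathlib

/-- The ordinary paperfolding word over `{0,1}`, indexed from 1:
writing `n = n' * 2^k` with `n'` odd, `pf n = 0` if `n' ≡ 1 (mod 4)`
and `pf n = 1` if `n' ≡ 3 (mod 4)`.  (The value at `0` is irrelevant.) -/
def pf (n : ℕ) : ℕ := if (n / 2 ^ (n.factorization 2)) % 4 = 1 then 0 else 1

/-- The factor `f_i f_{i+1} ⋯ f_{i+n-1}` of the paperfolding word,
of length `n`, starting at position `i`. -/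
def pfFactor (i n : ℕ) : List ℕ := (List.range n).map (fun j => pf (i + j))

/-- `w` is a factor of the ordinary paperfolding word. -/
def IsPFFactor (w : List ℕ) : Prop := ∃ i : ℕ, 1 ≤ i ∧ w = pfFactor i w.length

/-- The abelian complexity function of the ordinary paperfolding word:
the number of abelian equivalence classes of factors of length `n`,
where the class of a factor `w` is determined by the pair
`(|w|_0, |w|_1)` of numbers of occurrences of `0` and `1` in `w`. -/
noncomputable def ρ (n : ℕ) : ℕ :=
  {p : ℕ × ℕ | ∃ i : ℕ, 1 ≤ i ∧
    p = ((pfFactor i n).count 0, (pfFactor i n).count 1)}.ncard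

/-- `Δ w = |w|_0 - |w|_1`. -/
def Δ (w : List ℕ) : ℤ := (w.count 0 : ℤ) - (w.count 1 : ℤ)

/-- `M n` is the maximum of `Δ w` over all factors `w` of the
paperfolding word of length `n`. -/
noncomputable def M (n : ℕ) : ℤ :=
  sSup {d : ℤ | ∃ i : ℕ, 1 ≤ i ∧ d = Δ (pfFactor i n)}

theorem pf_two_mul (k : ℕ) : pf (2 * k) = pf k := by
  rcases Nat.eq_zero_or_pos k with rfl | hk
  · rfl
  · have h : (2 * k).factorization 2 = k.factorization 2 + 1 := by
      rw [Nat.factorization_mul (by norm_num) hk.ne', Finsupp.add_apply,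
        Nat.prime_two.factorization_self, add_comm]
    unfold pf
    rw [h, pow_succ', Nat.mul_div_mul_left _ _ (by norm_num)]

theorem pf_of_odd {k : ℕ} (hk : k % 2 = 1) : pf k = if k % 4 = 1 then 0 else 1 := by
  have h : k.factorization 2 = 0 := Nat.factorization_eq_zero_of_not_dvd (by omega)
  simp [pf, h]

theorem pf_of_mod_four_eq_one {k : ℕ} (hk : k % 4 = 1) : pf k = 0 := by
  rw [pf_of_odd (by omega), if_pos hk]

theorem pf_of_mod_four_eq_three {k : ℕ} (hk : k % 4 = 3) : pf k = 1 := by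
  rw [pf_of_odd (by omega), if_neg (by omega)]

theorem pf_two_mul_add_one (k : ℕ) : pf (2 * k + 1) = k % 2 := by
  rw [pf_of_odd (by omega)]
  split_ifs <;> omega

theorem pf_le_one (k : ℕ) : pf k ≤ 1 := by
  unfold pf
  split_ifs <;> omega

/-- The number of ones in the factor of length `n` starting at position `i`. -/
def pfOnes (i n : ℕ) : ℕ := ∑ j ∈ Finset.range n, pf (i + j)

theorem pfOnes_succ (i n : ℕ) : pfOnes i (n + 1) = pfOnes i n + pf (i + n) :=
  Finset.sum_range_succ _ _

theorem pfOnes_succ_left (i n : ℕ) : pfOnes i (n + 1) = pf i + pfOnes (i + 1) n := by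
  simp only [pfOnes, Finset.sum_range_succ', add_zero]
  rw [add_comm]
  simp only [add_assoc, add_comm 1]

theorem pfOnes_shift (i n : ℕ) : pfOnes (i + 1) n + pf i = pfOnes i n + pf (i + n) := by
  rw [← pfOnes_succ, pfOnes_succ_left, add_comm]

theorem pfOnes_add (i m n : ℕ) : pfOnes i (m + n) = pfOnes i m + pfOnes (i + m) n := by
  simp only [pfOnes, Finset.sum_range_add, add_assoc]

theorem pfOnes_le (i n : ℕ) : pfOnes i n ≤ n := by
  induction n with
  | zero => simp [pfOnes]
  | succ n ih => rw [pfOnes_succ]; have := pf_le_one (i + n); omega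

theorem count_pfFactor (i n : ℕ) :
    (pfFactor i n).count 0 + pfOnes i n = n ∧ (pfFactor i n).count 1 = pfOnes i n := by
  induction n with
  | zero => simp [pfFactor, pfOnes]
  | succ n ih =>
    have h : pfFactor i (n + 1) = pfFactor i n ++ [pf (i + n)] := by
      simp [pfFactor, List.range_succ]
    rw [h, pfOnes_succ, List.count_append, List.count_append]
    have := pf_le_one (i + n)
    interval_cases pf (i + n) <;> simp <;> omega

/-- The numbers of ones in the factors of length `n`. -/
def pfOnesSet (n : ℕ) : Set ℕ := {k | ∃ i, 1 ≤ i ∧ k = pfOnes i n}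

theorem rho_eq_ncard_pfOnesSet (n : ℕ) : ρ n = (pfOnesSet n).ncard := by
  have h : {p : ℕ × ℕ | ∃ i : ℕ, 1 ≤ i ∧
      p = ((pfFactor i n).count 0, (pfFactor i n).count 1)} =
      Set.image (fun k => (n - k, k)) (pfOnesSet n) := by
    ext p
    simp only [pfOnesSet, Set.mem_ofPred_eq, Set.mem_image]
    have hc (i : ℕ) : ((pfFactor i n).count 0, (pfFactor i n).count 1) =
        (n - pfOnes i n, pfOnes i n) := by
      have := count_pfFactor i n
      ext <;> simp only <;> omega
    constructor
    · rintro ⟨i, hi, rfl⟩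
      exact ⟨_, ⟨i, hi, rfl⟩, (hc i).symm⟩
    · rintro ⟨_, ⟨i, hi, rfl⟩, rfl⟩
      exact ⟨i, hi, (hc i).symm⟩
  rw [ρ, h, Set.ncard_image_of_injective]
  intro a b hab
  exact congrArg Prod.snd hab

theorem pfOnesSet_eq_Icc {n lo hi : ℕ} (hlo : IsLeast (pfOnesSet n) lo)
    (hhi : IsGreatest (pfOnesSet n) hi) : pfOnesSet n = Set.Icc lo hi := by
  refine Set.Subset.antisymm (fun k hk => ⟨hlo.2 hk, hhi.2 hk⟩) ?_
  rintro k ⟨hk₁, hk₂⟩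
  by_contra hk
  have hne : ∀ l, 1 ≤ l → pfOnes l n ≠ k := fun l hl h => hk ⟨l, hl, h.symm⟩
  have below : ∀ l d, 1 ≤ l → pfOnes l n < k → pfOnes (l + d) n < k := by
    intro l d hl h
    induction d with
    | zero => exact h
    | succ d ih =>
      have := pfOnes_shift (l + d) n
      have := pf_le_one (l + d + n)
      have := hne (l + (d + 1)) (by omega)
      rw [← add_assoc] at this ⊢
      omega
  have above : ∀ l d, 1 ≤ l → k < pfOnes l n → k < pfOnes (l + d) n := by
    intro l d hl h
    induction d with
    | zero => exact h
    | succ d ih =>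
      have := pfOnes_shift (l + d) n
      have := pf_le_one (l + d)
      have := hne (l + (d + 1)) (by omega)
      rw [← add_assoc] at this ⊢
      omega
  obtain ⟨i, hi₁, rfl⟩ := hlo.1
  obtain ⟨j, hj₁, rfl⟩ := hhi.1
  have hi₂ := hne i hi₁
  have hj₂ := hne j hj₁
  rcases le_total i j with h | h
  · have := below i (j - i) hi₁ (by omega)
    rw [Nat.add_sub_cancel' h] at this
    omega
  · have := above j (i - j) hj₁ (by omega)
    rw [Nat.add_sub_cancel' h] at this
    omega

theorem rho_add_eq {n lo hi : ℕ} (hlo : IsLeast (pfOnesSet n) lo)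
    (hhi : IsGreatest (pfOnesSet n) hi) : ρ n + lo = hi + 1 := by
  have hle : lo ≤ hi := hlo.2 hhi.1
  rw [rho_eq_ncard_pfOnesSet, pfOnesSet_eq_Icc hlo hhi, ← Finset.coe_Icc,
    Set.ncard_coe_finset, Nat.card_Icc]
  omega

theorem exists_isLeast_pfOnesSet (n : ℕ) : ∃ lo, IsLeast (pfOnesSet n) lo :=
  ⟨sInf (pfOnesSet n), Nat.sInf_mem ⟨_, 1, le_rfl, rfl⟩, fun _ h => Nat.sInf_le h⟩

theorem exists_isGreatest_pfOnesSet (n : ℕ) : ∃ hi, IsGreatest (pfOnesSet n) hi := by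
  have hb : BddAbove (pfOnesSet n) := ⟨n, by rintro _ ⟨i, -, rfl⟩; exact pfOnes_le i n⟩
  exact ⟨sSup (pfOnesSet n), Nat.sSup_mem ⟨_, 1, le_rfl, rfl⟩ hb, fun _ h => le_csSup hb h⟩

theorem pfOnes_four (i : ℕ) :
    pfOnes i 4 = pf i + pf (i + 1) + pf (i + 2) + pf (i + 3) := by
  simp [pfOnes, Finset.sum_range_succ]

theorem pf_four_mul (c : ℕ) : pf (4 * c) = pf c := by
  rw [show 4 * c = 2 * (2 * c) by ring, pf_two_mul, pf_two_mul]

theorem pf_four_mul_add_two (c : ℕ) : pf (4 * c + 2) = c % 2 := by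
  rw [show 4 * c + 2 = 2 * (2 * c + 1) by ring, pf_two_mul, pf_two_mul_add_one]

theorem pfOnes_four_mul_four (c : ℕ) :
    pfOnes (4 * c) 4 = pf c + c % 2 + 1 := by
  rw [pfOnes_four, pf_four_mul, pf_four_mul_add_two, pf_of_mod_four_eq_one (by omega : (4 * c + 1) % 4 = 1),
    pf_of_mod_four_eq_three (by omega : (4 * c + 3) % 4 = 3)]
  ring

theorem pfOnes_four_mul (c n : ℕ) :
    pfOnes (4 * c) (16 * n + 4) = pfOnes c (4 * n + 1) + 6 * n + c % 2 + 1 := by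
  induction n generalizing c with
  | zero =>
    rw [show 16 * 0 + 4 = 4 by rfl, pfOnes_four_mul_four]
    simp [pfOnes]
  | succ n ih =>
    rw [show 16 * (n + 1) + 4 = 4 + (4 + (4 + (4 + (16 * n + 4)))) by ring,
      show 4 * (n + 1) + 1 = 4 + (4 * n + 1) by ring, pfOnes_add, pfOnes_add, pfOnes_add,
      pfOnes_add, pfOnes_add c 4, pfOnes_four c]
    simp only [← Nat.mul_succ, Nat.succ_eq_add_one, pfOnes_four_mul_four, ih, add_assoc,
      Nat.reduceAdd]
    omega

theorem pfOnes_four_mul_add_zero (c n : ℕ) :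
    pfOnes (4 * c) (16 * n + 5) =
      pfOnes c (4 * n + 1) + pf (c + (4 * n + 1)) + 6 * n + c % 2 + 1 := by
  rw [pfOnes_succ, pfOnes_four_mul,
    show 4 * c + (16 * n + 4) = 4 * (c + (4 * n + 1)) by ring, pf_four_mul]
  ring

theorem pfOnes_four_mul_add_one (c n : ℕ) :
    pfOnes (4 * c + 1) (16 * n + 5) = pfOnes (c + 1) (4 * n + 1) + 6 * n + c % 2 + 1 := by
  have h := pfOnes_shift (4 * c) (16 * n + 5)
  have h' := pfOnes_shift c (4 * n + 1)
  rw [pfOnes_four_mul_add_zero, pf_four_mul,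
    pf_of_mod_four_eq_one (by omega : (4 * c + (16 * n + 5)) % 4 = 1)] at h
  omega

theorem pfOnes_four_mul_add_two (c n : ℕ) :
    pfOnes (4 * c + 2) (16 * n + 5) = pfOnes (c + 1) (4 * n + 1) + 6 * n + 2 := by
  have h := pfOnes_shift (4 * c + 1) (16 * n + 5)
  rw [pfOnes_four_mul_add_one, pf_of_mod_four_eq_one (by omega : (4 * c + 1) % 4 = 1),
    show 4 * c + 1 + (16 * n + 5) = 4 * (c + (4 * n + 1)) + 2 by ring,
    pf_four_mul_add_two] at h
  change pfOnes (4 * c + 2) _ + _ = _ at h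
  omega

theorem pfOnes_four_mul_add_three (c n : ℕ) :
    pfOnes (4 * c + 3) (16 * n + 5) =
      pfOnes (c + 1) (4 * n + 1) + 6 * n + 2 + (c + 1) % 2 := by
  have h := pfOnes_shift (4 * c + 2) (16 * n + 5)
  rw [pfOnes_four_mul_add_two, pf_four_mul_add_two,
    pf_of_mod_four_eq_three (by omega : (4 * c + 2 + (16 * n + 5)) % 4 = 3)] at h
  change pfOnes (4 * c + 3) _ + _ = _ at h
  omega

theorem pfOnes_mem_bounds {n lo hi : ℕ} (hlo : IsLeast (pfOnesSet (4 * n + 1)) lo)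
    (hhi : IsGreatest (pfOnesSet (4 * n + 1)) hi) {a : ℕ} (ha : 1 ≤ a) :
    lo + 6 * n + 1 ≤ pfOnes a (16 * n + 5) ∧ pfOnes a (16 * n + 5) ≤ hi + 6 * n + 3 := by
  have hb (c : ℕ) (hc : 1 ≤ c) :
      lo ≤ pfOnes c (4 * n + 1) ∧ pfOnes c (4 * n + 1) ≤ hi :=
    ⟨hlo.2 ⟨c, hc, rfl⟩, hhi.2 ⟨c, hc, rfl⟩⟩
  obtain ⟨c, h⟩ : ∃ c, a = 4 * c ∨ a = 4 * c + 1 ∨ a = 4 * c + 2 ∨ a = 4 * c + 3 :=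
    ⟨a / 4, by omega⟩
  have hs := hb (c + 1) (by omega)
  rcases h with rfl | rfl | rfl | rfl
  · have := hb c (by omega)
    have := pf_le_one (c + (4 * n + 1))
    rw [pfOnes_four_mul_add_zero]
    omega
  · rw [pfOnes_four_mul_add_one]
    omega
  · rw [pfOnes_four_mul_add_two]
    omega
  · rw [pfOnes_four_mul_add_three]
    omega

/-- Among the factors of length `4 * n + 1`, the least number of ones is attained at an odd
position. -/
theorem exists_odd_pfOnes_le (n : ℕ) {x : ℕ} (hx : 1 ≤ x) :
    ∃ c, c % 2 = 0 ∧ pfOnes (c + 1) (4 * n + 1) ≤ pfOnes x (4 * n + 1) := by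
  rcases (by omega : x % 2 = 1 ∨ x % 4 = 0 ∨ x % 4 = 2) with h | h | h
  · exact ⟨x - 1, by omega, by rw [Nat.sub_add_cancel hx]⟩
  · have hs := pfOnes_shift x (4 * n + 1)
    rw [pf_of_mod_four_eq_one (by omega : (x + (4 * n + 1)) % 4 = 1)] at hs
    exact ⟨x, by omega, by omega⟩
  · obtain ⟨y, rfl⟩ : ∃ y, x = y + 2 := ⟨x - 2, by omega⟩
    have hs := pfOnes_shift (y + 1) (4 * n + 1)
    rw [pf_of_mod_four_eq_one (by omega : (y + 1) % 4 = 1)] at hs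
    change pfOnes (y + 2) _ + _ = _ at hs
    exact ⟨y, by omega, by omega⟩

/-- Among the factors of length `4 * n + 1`, the greatest number of ones is attained at an odd
position. -/
theorem exists_odd_le_pfOnes (n : ℕ) {x : ℕ} (hx : 1 ≤ x) :
    ∃ c, c % 2 = 0 ∧ pfOnes x (4 * n + 1) ≤ pfOnes (c + 1) (4 * n + 1) := by
  rcases (by omega : x % 2 = 1 ∨ x % 4 = 2 ∨ x % 4 = 0) with h | h | h
  · exact ⟨x - 1, by omega, by rw [Nat.sub_add_cancel hx]⟩
  · have hs := pfOnes_shift x (4 * n + 1)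
    rw [pf_of_mod_four_eq_three (by omega : (x + (4 * n + 1)) % 4 = 3)] at hs
    have := pf_le_one x
    exact ⟨x, by omega, by omega⟩
  · obtain ⟨y, rfl⟩ : ∃ y, x = y + 2 := ⟨x - 2, by omega⟩
    have hs := pfOnes_shift (y + 1) (4 * n + 1)
    rw [pf_of_mod_four_eq_three (by omega : (y + 1) % 4 = 3)] at hs
    change pfOnes (y + 2) _ + _ = _ at hs
    have := pf_le_one (y + 1 + (4 * n + 1))
    exact ⟨y, by omega, by omega⟩

theorem pf_rho_sixteen_mul_add_five : ∀ n : ℕ, ρ (16 * n + 5) = ρ (4 * n + 1) + 2 := by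
  intro n
  obtain ⟨lo, hlo⟩ := exists_isLeast_pfOnesSet (4 * n + 1)
  obtain ⟨hi, hhi⟩ := exists_isGreatest_pfOnesSet (4 * n + 1)
  have hlo' : IsLeast (pfOnesSet (16 * n + 5)) (lo + 6 * n + 1) := by
    refine ⟨?_, by rintro _ ⟨a, ha, rfl⟩; exact (pfOnes_mem_bounds hlo hhi ha).1⟩
    obtain ⟨x, hx, hxlo⟩ := hlo.1
    obtain ⟨c, hc, hcx⟩ := exists_odd_pfOnes_le n hx
    have := hlo.2 ⟨c + 1, by omega, rfl⟩
    exact ⟨4 * c + 1, by omega, by rw [pfOnes_four_mul_add_one]; omega⟩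
  have hhi' : IsGreatest (pfOnesSet (16 * n + 5)) (hi + 6 * n + 3) := by
    refine ⟨?_, by rintro _ ⟨a, ha, rfl⟩; exact (pfOnes_mem_bounds hlo hhi ha).2⟩
    obtain ⟨x, hx, hxhi⟩ := hhi.1
    obtain ⟨c, hc, hcx⟩ := exists_odd_le_pfOnes n hx
    have := hhi.2 ⟨c + 1, by omega, rfl⟩
    exact ⟨4 * c + 3, by omega, by rw [pfOnes_four_mul_add_three]; omega⟩
  have h := rho_add_eq hlo hhi
  have h' := rho_add_eq hlo' hhi'
  omega
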